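/- arXiv:1612.06491 — 7 statements merged into one kernel-verified Lean document; each statement's English description precedes it below -/
import Mathlib

section
/- Let S be a nonzero ℂ-linear subspace of the d×d complex matrices. Then the sequence n ↦ (mrk(S^{⊗n}))^{1/n} converges as n → ∞, its limit equals sup_{n≥1} (mrk(S^{⊗n}))^{1/n}, and this common value is finite and at most d. -/
open Matrix

noncomputable def mrk {m n : Type*} [Fintype m] [Fintype n]
    (S : Submodule ℂ (Matrix m n ℂ)) : ℕ :=
  sSup (Matrix.rank '' (S : Set (Matrix m n ℂ)))

noncomputable def tensorSpace {m₁ n₁ m₂ n₂ : Type*}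
    (S : Submodule ℂ (Matrix m₁ n₁ ℂ)) (T : Submodule ℂ (Matrix m₂ n₂ ℂ)) :
    Submodule ℂ (Matrix (m₁ × m₂) (n₁ × n₂) ℂ) :=
  Submodule.span ℂ {M | ∃ A ∈ S, ∃ B ∈ T, M = Matrix.kroneckerMap (· * ·) A B}

noncomputable def tensorPow {d : ℕ} (S : Submodule ℂ (Matrix (Fin d) (Fin d) ℂ)) (n : ℕ) :
    Submodule ℂ (Matrix (Fin n → Fin d) (Fin n → Fin d) ℂ) :=
  Submodule.span ℂ {M | ∃ A : Fin n → Matrix (Fin d) (Fin d) ℂ,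
    (∀ k, A k ∈ S) ∧ M = fun i j => ∏ k, A k (i k) (j k)}

noncomputable def spaceImageOf {ι κ : Type*} [Fintype κ]
    (S : Submodule ℂ (Matrix ι κ ℂ)) (U : Submodule ℂ (κ → ℂ)) : Submodule ℂ (ι → ℂ) :=
  Submodule.span ℂ {v | ∃ A ∈ S, ∃ u ∈ U, v = A.mulVec u}

def HasShrunkSubspace {ι : Type*} [Fintype ι]
    (S : Submodule ℂ (Matrix ι ι ℂ)) : Prop :=
  ∃ U : Submodule ℂ (ι → ℂ),
    Module.finrank ℂ (spaceImageOf S U) < Module.finrank ℂ U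

noncomputable def compSpace (p q m n : ℕ) : Submodule ℂ (Matrix (Fin m) (Fin n) ℂ) where
  carrier := {A | ∀ (i : Fin m) (j : Fin n), p ≤ (i : ℕ) → q ≤ (j : ℕ) → A i j = 0}
  add_mem' := by
    intro a b ha hb i j hi hj
    simp only [Matrix.add_apply, ha i j hi hj, hb i j hi hj, add_zero]
  zero_mem' := by intro i j _ _; rfl
  smul_mem' := by
    intro c a ha i j hi hj
    simp only [Matrix.smul_apply, ha i j hi hj, smul_zero]

/-- A matrix of rank `r` over a field can be compressed to the identity of size `r`. -/
theorem Matrix.exists_mul_mul_eq_one_of_rank {m n K : Type*} [Fintype m] [Fintype n]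
    [DecidableEq m] [DecidableEq n] [Field K] (A : Matrix m n K) :
    ∃ (P : Matrix (Fin A.rank) m K) (Q : Matrix n (Fin A.rank) K), P * A * Q = 1 := by
  let e : (Fin A.rank → K) ≃ₗ[K] LinearMap.range A.mulVecLin :=
    LinearEquiv.ofFinrankEq _ _ (Module.finrank_fin_fun K)
  obtain ⟨s, hs⟩ := A.mulVecLin.rangeRestrict.exists_rightInverse_of_surjective
    A.mulVecLin.range_rangeRestrict
  obtain ⟨t, ht⟩ := (Submodule.subtype (LinearMap.range A.mulVecLin)
    ∘ₗ e.toLinearMap).exists_leftInverse_of_injective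
    (LinearMap.ker_eq_bot.2 (Subtype.val_injective.comp e.injective))
  refine ⟨LinearMap.toMatrix' t, LinearMap.toMatrix' (s ∘ₗ e.toLinearMap), ?_⟩
  apply (Matrix.toLin' (R := K)).injective
  rw [Matrix.toLin'_mul, Matrix.toLin'_mul, Matrix.toLin'_toMatrix', Matrix.toLin'_toMatrix',
    Matrix.toLin'_one, ← ht, LinearMap.comp_assoc]
  congr 1
  refine LinearMap.ext fun v => ?_
  exact congrArg Subtype.val (LinearMap.congr_fun hs (e v))

/-- The rank is supermultiplicative under Kronecker products. -/
theorem Matrix.rank_mul_rank_le_rank_kronecker {m n m' n' K : Type*} [Fintype m] [Fintype n]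
    [Fintype m'] [Fintype n'] [DecidableEq m] [DecidableEq n] [DecidableEq m'] [DecidableEq n']
    [Field K] (A : Matrix m n K) (B : Matrix m' n' K) :
    A.rank * B.rank ≤ (Matrix.kroneckerMap (· * ·) A B).rank := by
  obtain ⟨P, Q, h⟩ := A.exists_mul_mul_eq_one_of_rank
  obtain ⟨P', Q', h'⟩ := B.exists_mul_mul_eq_one_of_rank
  have key : Matrix.kroneckerMap (· * ·) P P' * Matrix.kroneckerMap (· * ·) A B *
      Matrix.kroneckerMap (· * ·) Q Q' = 1 := by
    rw [← Matrix.mul_kronecker_mul, ← Matrix.mul_kronecker_mul, h, h', Matrix.one_kronecker_one]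
  calc A.rank * B.rank
      = (1 : Matrix (Fin A.rank × Fin B.rank) (Fin A.rank × Fin B.rank) K).rank := by
        simp [Matrix.rank_one]
    _ ≤ _ := by
      rw [← key]
      exact (Matrix.rank_mul_le_left _ _).trans (Matrix.rank_mul_le_right _ _)

theorem bddAbove_rank_image {m n : Type*} [Fintype m] [Fintype n]
    (S : Submodule ℂ (Matrix m n ℂ)) :
    BddAbove (Matrix.rank '' (S : Set (Matrix m n ℂ))) :=
  ⟨Fintype.card n, by rintro _ ⟨A, -, rfl⟩; exact A.rank_le_card_width⟩

theorem rank_le_mrk {m n : Type*} [Fintype m] [Fintype n]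
    {S : Submodule ℂ (Matrix m n ℂ)} {A : Matrix m n ℂ} (hA : A ∈ S) : A.rank ≤ mrk S :=
  le_csSup (bddAbove_rank_image S) ⟨A, hA, rfl⟩

theorem exists_rank_eq_mrk {m n : Type*} [Fintype m] [Fintype n]
    (S : Submodule ℂ (Matrix m n ℂ)) : ∃ A ∈ S, A.rank = mrk S :=
  Nat.sSup_mem (S.nonempty.image _) (bddAbove_rank_image S)

theorem mrk_le_card_width {m n : Type*} [Fintype m] [Fintype n]
    (S : Submodule ℂ (Matrix m n ℂ)) : mrk S ≤ Fintype.card n := by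
  obtain ⟨A, -, h⟩ := exists_rank_eq_mrk S
  exact h ▸ A.rank_le_card_width

theorem mrk_pos_of_ne_bot {m n : Type*} [Fintype m] [Fintype n]
    {S : Submodule ℂ (Matrix m n ℂ)} (hS : S ≠ ⊥) : 0 < mrk S := by
  obtain ⟨A, hA, h0⟩ := S.exists_mem_ne_zero_of_ne_bot hS
  refine lt_of_lt_of_le (Nat.pos_of_ne_zero fun h => h0 ?_) (rank_le_mrk hA)
  classical
  exact (Matrix.toLin' (R := ℂ)).map_eq_zero_iff.1
    (LinearMap.range_eq_bot.1 (Submodule.finrank_eq_zero.1 h))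

theorem tensorPow_ne_bot {d : ℕ} {S : Submodule ℂ (Matrix (Fin d) (Fin d) ℂ)} (hS : S ≠ ⊥)
    (n : ℕ) : tensorPow S n ≠ ⊥ := by
  obtain ⟨A, hA, h0⟩ := S.exists_mem_ne_zero_of_ne_bot hS
  obtain ⟨i, j, hij⟩ : ∃ i j, A i j ≠ 0 := by
    by_contra! h
    exact h0 (Matrix.ext h)
  refine (Submodule.ne_bot_iff _).2 ⟨_, Submodule.subset_span ⟨fun _ => A, fun _ => hA, rfl⟩, ?_⟩
  intro h
  have := congrFun (congrFun h fun _ => i) fun _ => j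
  simp [hij] at this

/-- External tensor products of elements of two tensor powers lie in the tensor power of the
sum of the exponents. -/
theorem kronecker_submatrix_mem_tensorPow {d m n : ℕ}
    {S : Submodule ℂ (Matrix (Fin d) (Fin d) ℂ)}
    {A : Matrix (Fin m → Fin d) (Fin m → Fin d) ℂ} (hA : A ∈ tensorPow S m)
    {B : Matrix (Fin n → Fin d) (Fin n → Fin d) ℂ} (hB : B ∈ tensorPow S n) :
    (Matrix.kroneckerMap (· * ·) A B).submatrix
      (Fin.appendEquiv m n).symm (Fin.appendEquiv m n).symm ∈ tensorPow S (m + n) := by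
  refine Submodule.span_induction₂ (p := fun A B _ _ => (Matrix.kroneckerMap (· * ·) A B).submatrix
      (Fin.appendEquiv m n).symm (Fin.appendEquiv m n).symm ∈ tensorPow S (m + n))
    ?_ ?_ ?_ ?_ ?_ ?_ ?_ hA hB
  · rintro _ _ ⟨X, hX, rfl⟩ ⟨Y, hY, rfl⟩
    refine Submodule.subset_span ⟨Fin.append X Y, fun k => ?_, ?_⟩
    · induction k using Fin.addCases <;> simp [hX, hY]
    · ext i j
      simp [Fin.prod_univ_add, Fin.appendEquiv, Matrix.kroneckerMap]
  · intro B _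
    simp
  · intro A _
    simp
  · intro A A' B _ _ _ h h'
    convert Submodule.add_mem _ h h' using 1
    ext i j
    simp [add_mul]
  · intro A B B' _ _ _ h h'
    convert Submodule.add_mem _ h h' using 1
    ext i j
    simp [mul_add]
  · intro c A B _ _ h
    convert Submodule.smul_mem _ c h using 1
    ext i j
    simp [mul_assoc]
  · intro c A B _ _ h
    convert Submodule.smul_mem _ c h using 1
    ext i j
    simp [mul_left_comm]

theorem mrk_tensorPow_mul_le {d : ℕ} (S : Submodule ℂ (Matrix (Fin d) (Fin d) ℂ)) (m n : ℕ) :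
    mrk (tensorPow S m) * mrk (tensorPow S n) ≤ mrk (tensorPow S (m + n)) := by
  obtain ⟨A, hA, h⟩ := exists_rank_eq_mrk (tensorPow S m)
  obtain ⟨B, hB, h'⟩ := exists_rank_eq_mrk (tensorPow S n)
  rw [← h, ← h']
  refine (A.rank_mul_rank_le_rank_kronecker B).trans ?_
  rw [← Matrix.rank_submatrix _ (Fin.appendEquiv m n).symm (Fin.appendEquiv m n).symm]
  exact rank_le_mrk (kronecker_submatrix_mem_tensorPow hA hB)

/-- Fekete's lemma for supermultiplicative sequences of positive integers with at most
exponential growth. -/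
theorem tendsto_rpow_inv_of_supermultiplicative {u : ℕ → ℕ} {d : ℕ} (hpos : ∀ n, 0 < u n)
    (hmul : ∀ m n, u m * u n ≤ u (m + n)) (hle : ∀ n, u n ≤ d ^ n) :
    ∃ L : ℝ,
      Filter.Tendsto (fun n : ℕ => (u n : ℝ) ^ ((n : ℝ)⁻¹)) Filter.atTop (nhds L) ∧
      L = ⨆ n : ℕ, (u (n + 1) : ℝ) ^ (((n : ℝ) + 1)⁻¹) ∧ L ≤ d := by
  have hposR : ∀ n, (0 : ℝ) < u n := fun n => Nat.cast_pos.2 (hpos n)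
  have hroot : ∀ n : ℕ, n ≠ 0 → (u n : ℝ) ^ ((n : ℝ)⁻¹) ≤ d := by
    intro n hn
    rw [Real.rpow_inv_le_iff_of_pos (hposR n).le d.cast_nonneg (by positivity), Real.rpow_natCast]
    exact_mod_cast hle n
  have hsub : Subadditive fun n => -Real.log (u n) := by
    intro m n
    rw [← neg_add, neg_le_neg_iff, ← Real.log_mul (hposR m).ne' (hposR n).ne']
    exact Real.log_le_log (mul_pos (hposR m) (hposR n)) (by exact_mod_cast hmul m n)
  have hexp : ∀ n : ℕ, (u n : ℝ) ^ ((n : ℝ)⁻¹) = Real.exp (-(-Real.log (u n) / n)) := by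
    intro n
    rw [Real.rpow_def_of_pos (hposR n), neg_div, neg_neg, div_eq_mul_inv]
  have hbdd : BddBelow (Set.range fun n : ℕ => -Real.log (u n) / n) := by
    refine ⟨-Real.log d, ?_⟩
    rintro _ ⟨n, rfl⟩
    rcases eq_or_ne n 0 with rfl | hn
    · simpa using Real.log_natCast_nonneg d
    · have := hroot n hn
      rw [hexp] at this
      have := (Real.le_log_iff_exp_le ((Real.exp_pos _).trans_le this)).2 this
      dsimp only
      linarith
  have hlim : Filter.Tendsto (fun n : ℕ => (u n : ℝ) ^ ((n : ℝ)⁻¹)) Filter.atTop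
      (nhds (Real.exp (-hsub.lim))) := by
    simp only [hexp]
    exact (Real.continuous_exp.tendsto _).comp (hsub.tendsto_lim hbdd).neg
  have hbddA : BddAbove (Set.range fun n : ℕ => (u (n + 1) : ℝ) ^ (((n : ℝ) + 1)⁻¹)) := by
    refine ⟨d, ?_⟩
    rintro _ ⟨n, rfl⟩
    exact_mod_cast hroot (n + 1) n.succ_ne_zero
  refine ⟨_, hlim, le_antisymm ?_ (ciSup_le fun n => ?_), ?_⟩
  · refine le_of_tendsto' ((Filter.tendsto_add_atTop_iff_nat 1).2 hlim) fun n => ?_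
    exact_mod_cast le_ciSup hbddA n
  · have := hsub.lim_le_div hbdd n.succ_ne_zero
    have h := hexp (n + 1)
    push_cast at h this
    rw [h]
    exact Real.exp_le_exp.2 (neg_le_neg this)
  · exact le_of_tendsto hlim ((Filter.eventually_ne_atTop 0).mono hroot)

theorem stmt1 {d : ℕ} (S : Submodule ℂ (Matrix (Fin d) (Fin d) ℂ)) (hS : S ≠ ⊥) :
    ∃ L : ℝ,
      Filter.Tendsto (fun n : ℕ => (mrk (tensorPow S n) : ℝ) ^ ((n : ℝ)⁻¹))
        Filter.atTop (nhds L) ∧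
      L = ⨆ n : ℕ, (mrk (tensorPow S (n + 1)) : ℝ) ^ (((n : ℝ) + 1)⁻¹) ∧
      L ≤ d :=
  tendsto_rpow_inv_of_supermultiplicative (fun n => mrk_pos_of_ne_bot (tensorPow_ne_bot hS n))
    (mrk_tensorPow_mul_le S)
    fun n => by simpa using mrk_le_card_width (tensorPow S n)
end

section
/- Let X, Y be m×n complex matrices. If the image of Ker(X) under Y is not contained in Im(X), i.e. Y·Ker(X) ⊄ Im(X), then the set {r ∈ ℂ : rank(X + r·Y) ≤ rank(X)} has cardinality at most rank(X) + 1. In particular, rank(X + r·Y) > rank(X) for all but at most rank(X) + 1 values of r ∈ ℂ. -/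
open Matrix

/-- If `A` is the coordinate projection with a single zero at `none` and `B` has the corresponding
unit vector as its column `none`, the pencil `A + r • B` has a nonzero determinant polynomial. -/
theorem pencil_det_ne_zero {ι K : Type*} [Fintype ι] [DecidableEq ι] [Field K]
    (A B : Matrix (Option ι) (Option ι) K)
    (hA : A = diagonal fun j => j.elim 0 fun _ => 1)
    (hB : ∀ i, B i none = (1 : Matrix (Option ι) (Option ι) K) i none) :
    det ((Polynomial.X : Polynomial K) • B.map Polynomial.C + A.map Polynomial.C) ≠ 0 := by
  set B' : Matrix (Option ι) (Option ι) K := of fun i j => j.elim 0 fun k => B i (some k) with hB'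
  set Q : Matrix (Option ι) (Option ι) (Polynomial K) :=
    (Polynomial.X : Polynomial K) • B'.map Polynomial.C
      + (1 : Matrix (Option ι) (Option ι) K).map Polynomial.C with hQ
  have hfac : (Polynomial.X : Polynomial K) • B.map Polynomial.C + A.map Polynomial.C =
      Q * diagonal fun j => j.elim Polynomial.X fun _ => 1 := by
    ext1 i j
    rw [mul_diagonal]
    cases j with
    | none =>
      by_cases hi : i = none <;> simp [hQ, hB', hA, hB, one_apply, hi]
    | some k =>
      by_cases hi : i = some k <;> simp [hQ, hB', hA, one_apply, hi]
  have hQ0 : Q.det ≠ 0 := by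
    intro h0
    have h1 := Polynomial.coeff_det_X_add_C_zero B' (1 : Matrix (Option ι) (Option ι) K)
    rw [← hQ, h0] at h1
    simp at h1
  rw [hfac, det_mul, det_diagonal]
  refine mul_ne_zero hQ0 ?_
  simp [Fintype.prod_option]

/-- The values at which a square pencil with nonzero determinant polynomial degenerates are finitely
many, at most the size of the pencil. -/
theorem finite_ncard_det_pencil_eq_zero {κ K : Type*} [Fintype κ] [DecidableEq κ] [Field K]
    (A B : Matrix κ κ K)
    (h : det ((Polynomial.X : Polynomial K) • B.map Polynomial.C + A.map Polynomial.C) ≠ 0) :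
    {r : K | (A + r • B).det = 0}.Finite ∧
      {r : K | (A + r • B).det = 0}.ncard ≤ Fintype.card κ := by
  classical
  set p := det ((Polynomial.X : Polynomial K) • B.map Polynomial.C + A.map Polynomial.C) with hp
  have hset : {r : K | (A + r • B).det = 0} ⊆ (p.roots.toFinset : Set K) := by
    intro r hr
    have heval : p.eval r = (A + r • B).det := by
      rw [hp, ← Polynomial.coe_evalRingHom, RingHom.map_det]
      congr 1
      ext i j
      simp [add_comm, mul_comm r]
    exact Multiset.mem_toFinset.mpr ((Polynomial.mem_roots h).mpr (heval.trans hr))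
  refine ⟨(Finset.finite_toSet _).subset hset, ?_⟩
  calc {r : K | (A + r • B).det = 0}.ncard
      ≤ (p.roots.toFinset : Set K).ncard := Set.ncard_le_ncard hset (Finset.finite_toSet _)
    _ = p.roots.toFinset.card := Set.ncard_coe_finset _
    _ ≤ p.roots.card := Multiset.toFinset_card_le _
    _ ≤ p.natDegree := p.card_roots'
    _ ≤ Fintype.card κ := Polynomial.natDegree_det_X_add_C_le B A

/-- Compressing the pencil `X + r • Y` to size `X.rank + 1`, so that `X` becomes a coordinate
projection of corank one whose kernel is fixed by `Y`. -/
theorem exists_compression {m n K : Type*} [Fintype m] [Fintype n] [Field K]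
    (X Y : Matrix m n K)
    (h : ¬ Submodule.map (mulVecLin Y) (LinearMap.ker (mulVecLin X)) ≤
      LinearMap.range (mulVecLin X)) :
    ∃ (C : Matrix (Option (Fin X.rank)) m K) (V : Matrix n (Option (Fin X.rank)) K),
      C * X * V = diagonal (fun j => j.elim 0 fun _ => 1) ∧
      ∀ i, (C * Y * V) i none =
        (1 : Matrix (Option (Fin X.rank)) (Option (Fin X.rank)) K) i none := by
  classical
  obtain ⟨_, ⟨u, hu, rfl⟩, hYu⟩ := SetLike.not_le_iff_exists.mp h
  have hXu : X *ᵥ u = 0 := hu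
  let b : Module.Basis (Fin X.rank) K (LinearMap.range X.mulVecLin) := Module.finBasis K _
  choose v hv using fun i => (b i).2
  let w : Option (Fin X.rank) → m → K := fun j => j.elim (Y *ᵥ u) fun i => X *ᵥ v i
  have hw : LinearIndependent K w := by
    have hsome : (fun i : Fin X.rank => X *ᵥ v i) = fun i => (b i : m → K) := funext hv
    rw [linearIndependent_option]
    refine ⟨?_, ?_⟩
    · change LinearIndependent K fun i : Fin X.rank => X *ᵥ v i
      rw [hsome]
      exact b.linearIndependent.map' (Submodule.subtype _) (Submodule.ker_subtype _)
    · intro hmem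
      refine hYu (Submodule.span_le.mpr ?_ hmem)
      rintro _ ⟨i, rfl⟩
      exact ⟨v i, rfl⟩
  obtain ⟨L, hL⟩ := (Fintype.linearCombination K w).exists_leftInverse_of_injective
    (LinearMap.ker_eq_bot.mpr hw.fintypeLinearCombination_injective)
  have hLw : ∀ j, L.toMatrix' *ᵥ w j = Pi.single j 1 := fun j => by
    have := LinearMap.congr_fun hL (Pi.single j 1)
    simpa [Fintype.linearCombination_apply_single, LinearMap.toMatrix'_mulVec] using this
  let V : Matrix n (Option (Fin X.rank)) K := of fun i j => j.elim (u i) fun k => v k i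
  have hcol : ∀ (Z : Matrix m n K) i j,
      (L.toMatrix' * Z * V) i j = (L.toMatrix' *ᵥ (Z *ᵥ V.col j)) i := fun Z i j => by
    rw [mulVec_mulVec]; rfl
  refine ⟨L.toMatrix', V, ?_, fun i => ?_⟩
  · ext i j
    rw [hcol]
    cases j with
    | none =>
      have hc : X *ᵥ V.col none = 0 := hXu
      by_cases hi : i = none <;> simp [hc, hi]
    | some k =>
      have hc : X *ᵥ V.col (some k) = w (some k) := rfl
      rw [hc, hLw]
      by_cases hi : i = some k <;> simp [hi]
  · have hc : Y *ᵥ V.col none = w none := rfl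
    rw [hcol, hc, hLw, one_apply, Pi.single_apply]

theorem stmt5 {m n : ℕ} (X Y : Matrix (Fin m) (Fin n) ℂ)
    (h : ¬ Submodule.map (Matrix.mulVecLin Y) (LinearMap.ker (Matrix.mulVecLin X)) ≤
        LinearMap.range (Matrix.mulVecLin X)) :
    {r : ℂ | (X + r • Y).rank ≤ X.rank}.Finite ∧
    {r : ℂ | (X + r • Y).rank ≤ X.rank}.ncard ≤ X.rank + 1 := by
  obtain ⟨C, V, hA, hB⟩ := exists_compression X Y h
  obtain ⟨hfin, hcard⟩ := finite_ncard_det_pencil_eq_zero (C * X * V) (C * Y * V)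
    (pencil_det_ne_zero _ _ hA hB)
  have hsub : {r : ℂ | (X + r • Y).rank ≤ X.rank} ⊆
      {r : ℂ | (C * X * V + r • (C * Y * V)).det = 0} := by
    intro r hr
    by_contra hdet
    have hmul : C * X * V + r • (C * Y * V) = C * (X + r • Y) * V := by
      simp [Matrix.mul_add, Matrix.add_mul]
    have hle : (C * (X + r • Y) * V).rank ≤ X.rank :=
      (rank_mul_le_left _ _).trans ((rank_mul_le_right _ _).trans hr)
    rw [← hmul, rank_of_det_ne_zero hdet] at hle
    simp at hle
  exact ⟨hfin.subset hsub, (Set.ncard_le_ncard hsub hfin).trans (by simpa using hcard)⟩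
end

section
/- Let S be a ℂ-linear subspace of the m×n complex matrices and let E ∈ S attain the maximal rank, i.e. rank(E) = mrk(S). Then for every E' ∈ S, the image of Ker(E) under E' is contained in Im(E), i.e. E'·Ker(E) ⊆ Im(E). -/
open Matrix

/-- If `E'` maps some vector of `Ker E` outside `Im E`, then some perturbation of `E` along `E'`
has larger rank. -/
theorem exists_rank_lt_rank_add_smul {m n : Type*} [Fintype m] [Fintype n]
    {E E' : Matrix m n ℂ} {u : n → ℂ} (hu : E *ᵥ u = 0)
    (hE'u : E' *ᵥ u ∉ LinearMap.range E.mulVecLin) :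
    ∃ t : ℂ, E.rank < (E + t • E').rank := by
  let b := Module.finBasis ℂ (LinearMap.range E.mulVecLin)
  choose v hv using fun i => (b i).2
  let w : ℂ → Option (Fin (Module.finrank ℂ (LinearMap.range E.mulVecLin))) → m → ℂ :=
    fun t o => o.elim (E' *ᵥ u) fun i => E *ᵥ v i + t • (E' *ᵥ v i)
  have hw : Continuous w := by
    refine continuous_pi fun o => ?_
    cases o with
    | none => exact continuous_const
    | some i => exact continuous_const.add (continuous_id.smul continuous_const)
  have hnone (t : ℂ) : w t none = E' *ᵥ u := rfl
  have hsome (t : ℂ) (i) : w t (some i) = E *ᵥ v i + t • (E' *ᵥ v i) := rfl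
  clear_value w
  have hw0some : w 0 ∘ (↑) = (LinearMap.range E.mulVecLin).subtype ∘ b := by
    funext i
    simpa [hsome] using hv i
  have hw0 : LinearIndependent ℂ (w 0) := by
    rw [linearIndependent_option, hw0some, hnone]
    refine ⟨b.linearIndependent.map' _ (Submodule.ker_subtype _), fun h => hE'u ?_⟩
    refine Submodule.span_le.2 ?_ h
    rintro _ ⟨i, rfl⟩
    exact (b i).2
  have hev : ∀ᶠ t in nhds (0 : ℂ), LinearIndependent ℂ (w t) :=
    hw.continuousAt.eventually (isOpen_setOfPred_linearIndependent.mem_nhds hw0)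
  obtain ⟨t, hwt, ht⟩ :=
    ((hev.filter_mono nhdsWithin_le_nhds).and (self_mem_nhdsWithin (s := {0}ᶜ))).exists
  have ht : t ≠ 0 := ht
  refine ⟨t, ?_⟩
  have hmem : Submodule.span ℂ (Set.range (w t)) ≤ LinearMap.range (E + t • E').mulVecLin := by
    refine Submodule.span_le.2 ?_
    rintro _ ⟨_ | i, rfl⟩
    · exact ⟨t⁻¹ • u, by simp [hnone, hu, ht]⟩
    · exact ⟨v i, by simp [hsome]⟩
  have hle := Submodule.finrank_mono hmem
  rw [finrank_span_eq_card hwt, Fintype.card_option, Fintype.card_fin] at hle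
  exact hle

theorem stmt6 {m n : ℕ} (S : Submodule ℂ (Matrix (Fin m) (Fin n) ℂ))
    (E : Matrix (Fin m) (Fin n) ℂ) (hE : E ∈ S) (hrank : E.rank = mrk S) :
    ∀ E' ∈ S,
      Submodule.map (Matrix.mulVecLin E') (LinearMap.ker (Matrix.mulVecLin E)) ≤
        LinearMap.range (Matrix.mulVecLin E) := by
  rintro E' hE' _ ⟨u, hu, rfl⟩
  by_contra h
  obtain ⟨t, ht⟩ := exists_rank_lt_rank_add_smul (E := E) (LinearMap.mem_ker.1 hu) h
  have hle := rank_le_mrk (S.add_mem hE (S.smul_mem t hE'))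
  omega
end

section
/- Let S₁ ≤ M(d₁,ℂ) and S₂ ≤ M(d₂,ℂ) be ℂ-linear subspaces of square complex matrices, neither of which has a shrunk subspace. Then the tensor product space S₁ ⊗ S₂ ≤ M(d₁d₂,ℂ) has no shrunk subspace. -/
open Matrix

section LinearFamilies

variable {K V W E F : Type*} [Field K] [AddCommGroup V] [Module K V] [AddCommGroup W] [Module K W]
  [AddCommGroup E] [Module K E] [AddCommGroup F] [Module K F]

/-- A family of linear maps does not shrink any subspace. -/
def NonShrinking {I : Type*} (f : I → V →ₗ[K] W) : Prop :=
  ∀ U : Submodule K V, Module.finrank K U ≤ Module.finrank K (⨆ i, U.map (f i) : Submodule K W)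

theorem Submodule.finrank_map_add_finrank_inf_ker [FiniteDimensional K E] (p : E →ₗ[K] V)
    (U : Submodule K E) :
    Module.finrank K (U.map p) + Module.finrank K (U ⊓ LinearMap.ker p : Submodule K E) =
      Module.finrank K U := by
  have h := (p.domRestrict U).finrank_range_add_finrank_ker
  rw [LinearMap.range_domRestrict] at h
  rw [← h, LinearMap.ker_domRestrict, ← Submodule.finrank_map_subtype_eq U,
    Submodule.map_comap_subtype]

/-- A family acting coordinatewise through a non-shrinking family is non-shrinking. -/
theorem NonShrinking.of_coordinates {I κ : Type*} [Finite κ] [FiniteDimensional K E]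
    [FiniteDimensional K F] {f : I → V →ₗ[K] W} (hf : NonShrinking f) (g : I → E →ₗ[K] F)
    (p : κ → E →ₗ[K] V) (q : κ → F →ₗ[K] W) (hp : ∀ x, (∀ k, p k x = 0) → x = 0)
    (hpq : ∀ i k x, q k (g i x) = f i (p k x)) : NonShrinking g := by
  classical
  have := Fintype.ofFinite κ
  suffices H : ∀ (s : Finset κ) (U : Submodule K E), (∀ x ∈ U, ∀ k ∉ s, p k x = 0) →
      Module.finrank K U ≤ Module.finrank K (⨆ i, U.map (g i) : Submodule K F) from
    fun U => H Finset.univ U (by simp)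
  intro s
  induction s using Finset.induction_on with
  | empty =>
    intro U hU
    obtain rfl : U = ⊥ :=
      (Submodule.eq_bot_iff U).2 fun x hx => hp x fun k => hU x hx k (by simp)
    rw [finrank_bot]
    exact Nat.zero_le _
  | insert a s _ ih =>
    intro U hU
    have hker := ih (U ⊓ LinearMap.ker (p a)) fun x hx k hk => by
      by_cases hka : k = a
      · exact hka ▸ hx.2
      · exact hU x hx.1 k (by simp [hka, hk])
    rw [← Submodule.finrank_map_add_finrank_inf_ker (p a) U,
      ← Submodule.finrank_map_add_finrank_inf_ker (q a) (⨆ i, U.map (g i))]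
    refine add_le_add ((hf (U.map (p a))).trans (le_of_eq ?_)) (hker.trans (Submodule.finrank_mono ?_))
    · have hcomp (i : I) : f i ∘ₗ p a = q a ∘ₗ g i := LinearMap.ext fun x => (hpq i a x).symm
      rw [Submodule.map_iSup]
      have hmap (i : I) : (U.map (p a)).map (f i) = (U.map (g i)).map (q a) := by
        rw [← Submodule.map_comp, ← Submodule.map_comp, hcomp]
      rw [iSup_congr hmap]
    · refine iSup_le fun i => ?_
      rintro _ ⟨x, ⟨hxU, hxa⟩, rfl⟩
      refine ⟨Submodule.mem_iSup_of_mem i ⟨x, hxU, rfl⟩, ?_⟩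
      rw [SetLike.mem_coe, LinearMap.mem_ker] at hxa ⊢
      rw [hpq, hxa, map_zero]

end LinearFamilies

theorem spaceImageOf_eq_iSup {ι κ : Type*} [Fintype κ] (S : Submodule ℂ (Matrix ι κ ℂ))
    (U : Submodule ℂ (κ → ℂ)) :
    spaceImageOf S U = ⨆ A : S, U.map (A : Matrix ι κ ℂ).mulVecLin := by
  apply le_antisymm
  · refine Submodule.span_le.2 ?_
    rintro _ ⟨A, hA, u, hu, rfl⟩
    exact Submodule.mem_iSup_of_mem ⟨A, hA⟩ ⟨u, hu, rfl⟩
  · refine iSup_le fun A => ?_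
    rintro _ ⟨u, hu, rfl⟩
    exact Submodule.subset_span ⟨A, A.2, u, hu, rfl⟩

theorem not_hasShrunkSubspace_iff {ι : Type*} [Fintype ι] (S : Submodule ℂ (Matrix ι ι ℂ)) :
    ¬ HasShrunkSubspace S ↔
      NonShrinking fun A : S => (A : Matrix ι ι ℂ).mulVecLin := by
  simp only [HasShrunkSubspace, not_exists, not_lt]
  exact forall_congr' fun U => by rw [spaceImageOf_eq_iSup]

theorem stmt10 {d₁ d₂ : ℕ} (S₁ : Submodule ℂ (Matrix (Fin d₁) (Fin d₁) ℂ))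
    (S₂ : Submodule ℂ (Matrix (Fin d₂) (Fin d₂) ℂ))
    (h₁ : ¬ HasShrunkSubspace S₁) (h₂ : ¬ HasShrunkSubspace S₂) :
    ¬ HasShrunkSubspace (tensorSpace S₁ S₂) := by
  rw [not_hasShrunkSubspace_iff] at h₁ h₂ ⊢
  have hleft : NonShrinking fun A : S₁ =>
      (kroneckerMap (· * ·) (A : Matrix (Fin d₁) (Fin d₁) ℂ)
        (1 : Matrix (Fin d₂) (Fin d₂) ℂ)).mulVecLin := by
    refine h₁.of_coordinates _ (fun k => LinearMap.funLeft ℂ ℂ fun i => (i, k))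
      (fun k => LinearMap.funLeft ℂ ℂ fun i => (i, k))
      (fun x hx => funext fun ⟨i, k⟩ => congrFun (hx k) i) fun A k x => funext fun i => ?_
    simp [LinearMap.funLeft_apply, mulVec, dotProduct, Fintype.sum_prod_type, one_apply]
  have hright : NonShrinking fun B : S₂ =>
      (kroneckerMap (· * ·) (1 : Matrix (Fin d₁) (Fin d₁) ℂ)
        (B : Matrix (Fin d₂) (Fin d₂) ℂ)).mulVecLin := by
    refine h₂.of_coordinates _ (fun k => LinearMap.funLeft ℂ ℂ fun i => (k, i))
      (fun k => LinearMap.funLeft ℂ ℂ fun i => (k, i))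
      (fun x hx => funext fun ⟨k, i⟩ => congrFun (hx k) i) fun B k x => funext fun i => ?_
    simp [LinearMap.funLeft_apply, mulVec, dotProduct, Fintype.sum_prod_type_right, one_apply]
  intro U
  refine (hright U).trans ((hleft _).trans (Submodule.finrank_mono ?_))
  refine iSup_le fun A => ?_
  rw [Submodule.map_iSup]
  refine iSup_le fun B => ?_
  have hmem : kroneckerMap (· * ·) (A : Matrix (Fin d₁) (Fin d₁) ℂ)
      (B : Matrix (Fin d₂) (Fin d₂) ℂ) ∈ tensorSpace S₁ S₂ :=
    Submodule.subset_span ⟨A, A.2, B, B.2, rfl⟩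
  rw [← Submodule.map_comp, ← mulVecLin_mul, ← mul_kronecker_mul, mul_one, one_mul]
  exact le_iSup (fun M : tensorSpace S₁ S₂ =>
    U.map (M : Matrix (Fin d₁ × Fin d₂) (Fin d₁ × Fin d₂) ℂ).mulVecLin) ⟨_, hmem⟩
end

section
/- Let p, q, m, n be natural numbers with p ≤ m and q ≤ n, and let A(p,q,m,n) be the ℂ-linear subspace of m×n complex matrices consisting of all matrices whose (i,j) entry is zero whenever i ≥ p and j ≥ q (indices 0-based); equivalently, A(p,q,m,n) is the span of the elementary matrices whose nonzero entry lies in the first p rows or in the first q columns. Then mrk(A(p,q,m,n)) = min{p+q, m, n}. -/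
open Matrix

/-- A matrix vanishing outside the first `p` rows and the first `q` columns factors through a space
of dimension `p + q`. -/
lemma rank_le_add_of_mem_compSpace {p q m n : ℕ} (hp : p ≤ m) (hq : q ≤ n)
    {A : Matrix (Fin m) (Fin n) ℂ} (hA : A ∈ compSpace p q m n) : A.rank ≤ p + q := by
  let U : Matrix (Fin m) (Fin p ⊕ Fin q) ℂ := Matrix.of fun i =>
    Sum.elim (fun k => if (i : ℕ) = k then 1 else 0)
      (fun l => if (i : ℕ) < p then 0 else A i (Fin.castLE hq l))
  let V : Matrix (Fin p ⊕ Fin q) (Fin n) ℂ :=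
    Matrix.of fun s j => Sum.elim (fun k => A (Fin.castLE hp k) j)
      (fun l : Fin q => if (l : ℕ) = j then 1 else 0) s
  have hUV : A = U * V := by
    ext i j
    simp only [Matrix.mul_apply, Fintype.sum_sum_type, U, V, Matrix.of_apply, Sum.elim_inl,
      Sum.elim_inr]
    by_cases hi : (i : ℕ) < p
    · rw [Finset.sum_eq_single (⟨i, hi⟩ : Fin p)]
      · simp [hi]
      · intro k _ hk
        have : (i : ℕ) ≠ k := fun h => hk (Fin.ext h.symm)
        simp [this]
      · simp
    · have h₀ : ∀ k : Fin p, (i : ℕ) ≠ k := fun k => by have := k.isLt; omega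
      by_cases hj : (j : ℕ) < q
      · rw [Finset.sum_eq_single (a := (⟨j, hj⟩ : Fin q))]
        · simp [hi, h₀]
        · intro l _ hl
          have : (l : ℕ) ≠ j := fun h => hl (Fin.ext h)
          simp [this]
        · simp
      · have h₁ : ∀ l : Fin q, (l : ℕ) ≠ j := fun l => by have := l.isLt; omega
        simp [h₀, h₁, hA i j (not_lt.mp hi) (not_lt.mp hj)]
  calc A.rank = (U * V).rank := by rw [← hUV]
    _ ≤ U.rank := Matrix.rank_mul_le_left U V
    _ ≤ Fintype.card (Fin p ⊕ Fin q) := U.rank_le_card_width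
    _ = p + q := by simp

/-- The matrix with ones on the antidiagonal `i + j + 1 = r` attains rank `r`. -/
lemma exists_mem_compSpace_le_rank {p q m n r : ℕ} (hr : r ≤ p + q) (hm : r ≤ m) (hn : r ≤ n) :
    ∃ A ∈ compSpace p q m n, r ≤ A.rank := by
  let A : Matrix (Fin m) (Fin n) ℂ := Matrix.of fun i j => if (i : ℕ) + j + 1 = r then 1 else 0
  refine ⟨A, fun i j hi hj => if_neg (by omega), ?_⟩
  have hA : A.submatrix (Fin.castLE hm) (fun k => Fin.castLE hn k.rev) =
      (1 : Matrix (Fin r) (Fin r) ℂ) := by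
    ext i j
    have h : (i : ℕ) + (r - (j + 1)) + 1 = r ↔ i = j := by
      rw [Fin.ext_iff]
      omega
    simp [A, Matrix.one_apply, Fin.val_rev, h]
  calc r = (1 : Matrix (Fin r) (Fin r) ℂ).rank := by simp
    _ ≤ A.rank := by
      rw [← hA]
      exact A.rank_submatrix_le _ _

theorem stmt12 {p q m n : ℕ} (hp : p ≤ m) (hq : q ≤ n) :
    mrk (compSpace p q m n) = min (p + q) (min m n) := by
  have hub : ∀ k ∈ Matrix.rank '' (compSpace p q m n : Set (Matrix (Fin m) (Fin n) ℂ)),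
      k ≤ min (p + q) (min m n) := by
    rintro _ ⟨A, hA, rfl⟩
    exact le_min (rank_le_add_of_mem_compSpace hp hq hA) (le_min A.rank_le_height A.rank_le_width)
  obtain ⟨A, hA, hr⟩ := exists_mem_compSpace_le_rank (p := p) (q := q) (m := m) (n := n)
    (r := min (p + q) (min m n)) (by omega) (by omega) (by omega)
  exact le_antisymm (csSup_le ⟨_, A, hA, rfl⟩ hub)
    (hr.trans (le_csSup ⟨_, hub⟩ ⟨A, hA, rfl⟩))
end

section
/- Let A₁ = A(p₁,q₁,m₁,n₁) and A₂ = A(p₂,q₂,m₂,n₂) be maximal-compression matrix spaces, i.e. p₁+q₁ < min{m₁,n₁} and p₂+q₂ < min{m₂,n₂}. Then mrk(A₁ ⊗ A₂) = p₁p₂ + min{(n₁−q₁)q₂, p₁(m₂−p₂)} + min{(m₁−p₁)p₂, q₁(n₂−q₂)} + q₁q₂. -/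
open Matrix

namespace Matrix

theorem rank_add_le_add {α β : Type*} [Finite α] [Fintype β] (A B : Matrix α β ℂ) : (A + B).rank ≤ A.rank + B.rank := by
  have hle : LinearMap.range (A + B).mulVecLin ≤
      LinearMap.range A.mulVecLin ⊔ LinearMap.range B.mulVecLin := by
    rw [mulVecLin_add]
    exact LinearMap.range_add_le _ _
  exact (Submodule.finrank_mono hle).trans (Submodule.finrank_add_le_finrank_add_finrank _ _)

variable {α β ι : Type*} [Fintype α] [Fintype β] [Fintype ι]

theorem rank_diagonal_indicator_le [DecidableEq α] (S : Finset α) :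
    (diagonal fun i => if i ∈ S then (1 : ℂ) else 0).rank ≤ S.card := by
  rw [rank_diagonal, ← Fintype.card_coe S]
  exact Fintype.card_le_of_injective (fun x => ⟨x.1, by have := x.2; aesop⟩)
    (fun x y hxy => Subtype.ext (by simpa using hxy))

/-- A matrix supported on the rows in `R` and the columns in `C` has rank at most `#R + #C`. -/
theorem rank_le_card_add_card_of_cover (M : Matrix α β ℂ) (R : Finset α) (C : Finset β)
    (h : ∀ i j, i ∉ R → j ∉ C → M i j = 0) : M.rank ≤ R.card + C.card := by
  classical
  have key : M = (diagonal fun i => if i ∈ R then (1 : ℂ) else 0) * M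
      + (of fun i j => if i ∈ R then 0 else M i j) *
        (diagonal fun j => if j ∈ C then (1 : ℂ) else 0) := by
    ext i j
    by_cases hi : i ∈ R <;> by_cases hj : j ∈ C <;> simp [hi, hj]
    exact h i j hi hj
  rw [key]
  exact (rank_add_le_add _ _).trans (Nat.add_le_add
    ((rank_mul_le_left _ _).trans (rank_diagonal_indicator_le R))
    ((rank_mul_le_right _ _).trans (rank_diagonal_indicator_le C)))

/-- The rank of the partial permutation matrix of a matching is at least the matching's size. -/
theorem card_le_rank_sum_single [DecidableEq α] [DecidableEq β] {f : ι → α} {g : ι → β}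
    (hf : f.Injective) (hg : g.Injective) :
    Fintype.card ι ≤ (∑ t, single (f t) (g t) (1 : ℂ)).rank := by
  classical
  have key : (1 : Matrix ι ι ℂ) = (of fun t i => if f t = i then (1 : ℂ) else 0) *
      (∑ t, single (f t) (g t) (1 : ℂ)) * (of fun j t => if g t = j then (1 : ℂ) else 0) := by
    ext s t
    simp [mul_apply, sum_apply, single_apply, one_apply, ite_and, hf.eq_iff, hg.eq_iff]
  rw [← rank_one (R := ℂ) (n := ι), key]
  exact (rank_mul_le_left _ _).trans (rank_mul_le_right _ _)

end Matrix

theorem Finset.exists_injective_fin {α : Type*} {S : Finset α} {k : ℕ} (h : k ≤ S.card) :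
    ∃ f : Fin k → α, f.Injective ∧ ∀ t, f t ∈ S :=
  ⟨fun t => (S.equivFin.symm (Fin.castLE h t)).1,
    Subtype.val_injective.comp (S.equivFin.symm.injective.comp (Fin.castLE_injective h)),
    fun t => (S.equivFin.symm (Fin.castLE h t)).2⟩

/-- The indices of `Fin m` below `p`. -/
def lowIndices (p m : ℕ) : Finset (Fin m) := Finset.univ.filter fun i => (i : ℕ) < p

/-- The indices of `Fin m` from `p` on. -/
def highIndices (p m : ℕ) : Finset (Fin m) := Finset.univ.filter fun i => p ≤ (i : ℕ)

@[simp]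
theorem mem_lowIndices {p m : ℕ} {i : Fin m} : i ∈ lowIndices p m ↔ (i : ℕ) < p := by
  simp [lowIndices]

@[simp]
theorem mem_highIndices {p m : ℕ} {i : Fin m} : i ∈ highIndices p m ↔ p ≤ (i : ℕ) := by
  simp [highIndices]

theorem card_lowIndices {p m : ℕ} (h : p ≤ m) : (lowIndices p m).card = p := by
  rw [lowIndices, Fin.card_filter_val_lt]; omega

theorem card_highIndices (p m : ℕ) : (highIndices p m).card = m - p := by
  have h := Finset.card_filter_add_card_filter_not (s := Finset.univ)
    (fun i : Fin m => (i : ℕ) < p)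
  simp only [not_lt, Fin.card_filter_val_lt, Finset.card_univ, Fintype.card_fin] at h
  rw [highIndices]
  omega

section TensorSpace

variable {p₁ q₁ m₁ n₁ p₂ q₂ m₂ n₂ : ℕ}

theorem apply_eq_zero_of_mem_tensorSpace_compSpace
    {M : Matrix (Fin m₁ × Fin m₂) (Fin n₁ × Fin n₂) ℂ}
    (hM : M ∈ tensorSpace (compSpace p₁ q₁ m₁ n₁) (compSpace p₂ q₂ m₂ n₂))
    (i : Fin m₁ × Fin m₂) (j : Fin n₁ × Fin n₂)
    (h : (p₁ ≤ (i.1 : ℕ) ∧ q₁ ≤ (j.1 : ℕ)) ∨ (p₂ ≤ (i.2 : ℕ) ∧ q₂ ≤ (j.2 : ℕ))) :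
    M i j = 0 := by
  induction hM using Submodule.span_induction with
  | mem M hM =>
    obtain ⟨A, hA, B, hB, rfl⟩ := hM
    rw [kroneckerMap_apply]
    rcases h with h | h
    · rw [hA _ _ h.1 h.2, zero_mul]
    · rw [hB _ _ h.1 h.2, mul_zero]
  | zero => rfl
  | add M N _ _ hM hN => rw [Matrix.add_apply, hM, hN, add_zero]
  | smul c M _ hM => rw [Matrix.smul_apply, hM, smul_zero]

theorem single_mem_compSpace {p q m n : ℕ} {i : Fin m} {j : Fin n}
    (h : (i : ℕ) < p ∨ (j : ℕ) < q) : single i j (1 : ℂ) ∈ compSpace p q m n := by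
  intro i' j' hi hj
  rw [single_apply, if_neg]
  rintro ⟨rfl, rfl⟩
  omega

theorem single_mem_tensorSpace_compSpace {i : Fin m₁ × Fin m₂} {j : Fin n₁ × Fin n₂}
    (h₁ : (i.1 : ℕ) < p₁ ∨ (j.1 : ℕ) < q₁) (h₂ : (i.2 : ℕ) < p₂ ∨ (j.2 : ℕ) < q₂) :
    single i j (1 : ℂ) ∈ tensorSpace (compSpace p₁ q₁ m₁ n₁) (compSpace p₂ q₂ m₂ n₂) := by
  refine Submodule.subset_span ⟨_, single_mem_compSpace h₁, _, single_mem_compSpace h₂, ?_⟩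
  rw [kroneckerMap_single_single _ _ _ _ _ zero_mul mul_zero, mul_one]

theorem rank_le_of_mem_tensorSpace_compSpace
    (hp₁ : p₁ ≤ m₁) (hq₁ : q₁ ≤ n₁) (hp₂ : p₂ ≤ m₂) (hq₂ : q₂ ≤ n₂)
    {M : Matrix (Fin m₁ × Fin m₂) (Fin n₁ × Fin n₂) ℂ}
    (hM : M ∈ tensorSpace (compSpace p₁ q₁ m₁ n₁) (compSpace p₂ q₂ m₂ n₂)) :
    M.rank ≤ p₁ * p₂ + min ((n₁ - q₁) * q₂) (p₁ * (m₂ - p₂)) +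
        min ((m₁ - p₁) * p₂) (q₁ * (n₂ - q₂)) + q₁ * q₂ := by
  classical
  obtain ⟨R₁, C₁, hcard₁, hcov₁⟩ : ∃ (R : Finset (Fin m₁ × Fin m₂)) (C : Finset (Fin n₁ × Fin n₂)),
      R.card + C.card ≤ min ((n₁ - q₁) * q₂) (p₁ * (m₂ - p₂)) ∧
      ∀ i j, i ∈ lowIndices p₁ m₁ ×ˢ highIndices p₂ m₂ →
        j ∈ highIndices q₁ n₁ ×ˢ lowIndices q₂ n₂ → i ∈ R ∨ j ∈ C := by
    rcases le_total ((n₁ - q₁) * q₂) (p₁ * (m₂ - p₂)) with h | h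
    · exact ⟨∅, highIndices q₁ n₁ ×ˢ lowIndices q₂ n₂, by
        simp [card_lowIndices, card_highIndices, *], fun i j _ hj => Or.inr hj⟩
    · exact ⟨lowIndices p₁ m₁ ×ˢ highIndices p₂ m₂, ∅, by
        simp [card_lowIndices, card_highIndices, *], fun i j hi _ => Or.inl hi⟩
  obtain ⟨R₂, C₂, hcard₂, hcov₂⟩ : ∃ (R : Finset (Fin m₁ × Fin m₂)) (C : Finset (Fin n₁ × Fin n₂)),
      R.card + C.card ≤ min ((m₁ - p₁) * p₂) (q₁ * (n₂ - q₂)) ∧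
      ∀ i j, i ∈ highIndices p₁ m₁ ×ˢ lowIndices p₂ m₂ →
        j ∈ lowIndices q₁ n₁ ×ˢ highIndices q₂ n₂ → i ∈ R ∨ j ∈ C := by
    rcases le_total ((m₁ - p₁) * p₂) (q₁ * (n₂ - q₂)) with h | h
    · exact ⟨highIndices p₁ m₁ ×ˢ lowIndices p₂ m₂, ∅, by
        simp [card_lowIndices, card_highIndices, *], fun i j hi _ => Or.inl hi⟩
    · exact ⟨∅, lowIndices q₁ n₁ ×ˢ highIndices q₂ n₂, by
        simp [card_lowIndices, card_highIndices, *], fun i j _ hj => Or.inr hj⟩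
  have hbound := M.rank_le_card_add_card_of_cover
    (lowIndices p₁ m₁ ×ˢ lowIndices p₂ m₂ ∪ (R₁ ∪ R₂))
    (lowIndices q₁ n₁ ×ˢ lowIndices q₂ n₂ ∪ (C₁ ∪ C₂)) (by
      intro i j hi hj
      apply apply_eq_zero_of_mem_tensorSpace_compSpace hM
      have h₁ := hcov₁ i j
      have h₂ := hcov₂ i j
      simp only [Finset.mem_union, Finset.mem_product, mem_lowIndices, mem_highIndices]
        at hi hj h₁ h₂
      grind)
  have hR := Finset.card_union_le (lowIndices p₁ m₁ ×ˢ lowIndices p₂ m₂) (R₁ ∪ R₂)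
  have hR' := Finset.card_union_le R₁ R₂
  have hC := Finset.card_union_le (lowIndices q₁ n₁ ×ˢ lowIndices q₂ n₂) (C₁ ∪ C₂)
  have hC' := Finset.card_union_le C₁ C₂
  simp only [Finset.card_product, card_lowIndices, hp₁, hq₁, hp₂, hq₂] at hR hC
  omega

theorem exists_mem_tensorSpace_compSpace_le_rank
    (hp₁ : p₁ + q₁ ≤ m₁) (hq₁ : p₁ + q₁ ≤ n₁) (hp₂ : p₂ + q₂ ≤ m₂) (hq₂ : p₂ + q₂ ≤ n₂) :
    ∃ M ∈ tensorSpace (compSpace p₁ q₁ m₁ n₁) (compSpace p₂ q₂ m₂ n₂),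
      p₁ * p₂ + min ((n₁ - q₁) * q₂) (p₁ * (m₂ - p₂)) +
        min ((m₁ - p₁) * p₂) (q₁ * (n₂ - q₂)) + q₁ * q₂ ≤ M.rank := by
  have hlp₁ : p₁ ≤ m₁ := by omega
  have hlq₁ : q₁ ≤ n₁ := by omega
  have hlp₂ : p₂ ≤ m₂ := by omega
  have hlq₂ : q₂ ≤ n₂ := by omega
  have matching : ∀ (k : ℕ) (R₁ : Finset (Fin m₁)) (R₂ : Finset (Fin m₂)) (C₁ : Finset (Fin n₁))
      (C₂ : Finset (Fin n₂)), k ≤ R₁.card * R₂.card → k ≤ C₁.card * C₂.card →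
      ∃ (f : Fin k → Fin m₁ × Fin m₂) (g : Fin k → Fin n₁ × Fin n₂), f.Injective ∧ g.Injective ∧
        (∀ t, (f t).1 ∈ R₁ ∧ (f t).2 ∈ R₂) ∧ ∀ t, (g t).1 ∈ C₁ ∧ (g t).2 ∈ C₂ := by
    intro k R₁ R₂ C₁ C₂ hR hC
    obtain ⟨f, hf, hfR⟩ := Finset.exists_injective_fin (hR.trans_eq (Finset.card_product _ _).symm)
    obtain ⟨g, hg, hgC⟩ := Finset.exists_injective_fin (hC.trans_eq (Finset.card_product _ _).symm)
    exact ⟨f, g, hf, hg, fun t => Finset.mem_product.1 (hfR t),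
      fun t => Finset.mem_product.1 (hgC t)⟩
  obtain ⟨f₁, g₁, hf₁, hg₁, hR₁, hC₁⟩ := matching (p₁ * p₂)
    (lowIndices p₁ m₁) (lowIndices p₂ m₂) (highIndices q₁ n₁) (highIndices q₂ n₂)
    (by rw [card_lowIndices hlp₁, card_lowIndices hlp₂])
    (by rw [card_highIndices, card_highIndices]; exact Nat.mul_le_mul (by omega) (by omega))
  obtain ⟨f₂, g₂, hf₂, hg₂, hR₂, hC₂⟩ := matching (min ((n₁ - q₁) * q₂) (p₁ * (m₂ - p₂)))
    (lowIndices p₁ m₁) (highIndices p₂ m₂) (highIndices q₁ n₁) (lowIndices q₂ n₂)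
    (by rw [card_lowIndices hlp₁, card_highIndices]; exact min_le_right _ _)
    (by rw [card_highIndices, card_lowIndices hlq₂]; exact min_le_left _ _)
  obtain ⟨f₃, g₃, hf₃, hg₃, hR₃, hC₃⟩ := matching (min ((m₁ - p₁) * p₂) (q₁ * (n₂ - q₂)))
    (highIndices p₁ m₁) (lowIndices p₂ m₂) (lowIndices q₁ n₁) (highIndices q₂ n₂)
    (by rw [card_highIndices, card_lowIndices hlp₂]; exact min_le_left _ _)
    (by rw [card_lowIndices hlq₁, card_highIndices]; exact min_le_right _ _)
  obtain ⟨f₄, g₄, hf₄, hg₄, hR₄, hC₄⟩ := matching (q₁ * q₂)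
    (highIndices p₁ m₁) (highIndices p₂ m₂) (lowIndices q₁ n₁) (lowIndices q₂ n₂)
    (by rw [card_highIndices, card_highIndices]; exact Nat.mul_le_mul (by omega) (by omega))
    (by rw [card_lowIndices hlq₁, card_lowIndices hlq₂])
  simp only [mem_lowIndices, mem_highIndices] at hR₁ hC₁ hR₂ hC₂ hR₃ hC₃ hR₄ hC₄
  have hf : (Sum.elim (Sum.elim (Sum.elim f₁ f₂) f₃) f₄).Injective := by
    refine ((hf₁.sumElim hf₂ ?_).sumElim hf₃ ?_).sumElim hf₄ ?_ <;>
      grind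
  have hg : (Sum.elim (Sum.elim (Sum.elim g₁ g₂) g₃) g₄).Injective := by
    refine ((hg₁.sumElim hg₂ ?_).sumElim hg₃ ?_).sumElim hg₄ ?_ <;>
      grind
  refine ⟨_, Submodule.sum_mem _ fun t _ => ?_,
    le_trans ?_ (Matrix.card_le_rank_sum_single hf hg)⟩
  · rcases t with ((t | t) | t) | t
    · exact single_mem_tensorSpace_compSpace (Or.inl (hR₁ t).1) (Or.inl (hR₁ t).2)
    · exact single_mem_tensorSpace_compSpace (Or.inl (hR₂ t).1) (Or.inr (hC₂ t).2)
    · exact single_mem_tensorSpace_compSpace (Or.inr (hC₃ t).1) (Or.inl (hR₃ t).2)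
    · exact single_mem_tensorSpace_compSpace (Or.inr (hC₄ t).1) (Or.inr (hC₄ t).2)
  · simp only [Fintype.card_sum, Fintype.card_fin, le_refl]

end TensorSpace

theorem stmt13 {p₁ q₁ m₁ n₁ p₂ q₂ m₂ n₂ : ℕ}
    (h₁ : p₁ + q₁ < min m₁ n₁) (h₂ : p₂ + q₂ < min m₂ n₂) :
    mrk (tensorSpace (compSpace p₁ q₁ m₁ n₁) (compSpace p₂ q₂ m₂ n₂)) =
      p₁ * p₂ + min ((n₁ - q₁) * q₂) (p₁ * (m₂ - p₂)) +
        min ((m₁ - p₁) * p₂) (q₁ * (n₂ - q₂)) + q₁ * q₂ := by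
  rw [lt_min_iff] at h₁ h₂
  have hle : ∀ r ∈ Matrix.rank '' (tensorSpace (compSpace p₁ q₁ m₁ n₁) (compSpace p₂ q₂ m₂ n₂) :
      Set (Matrix (Fin m₁ × Fin m₂) (Fin n₁ × Fin n₂) ℂ)),
      r ≤ p₁ * p₂ + min ((n₁ - q₁) * q₂) (p₁ * (m₂ - p₂)) +
        min ((m₁ - p₁) * p₂) (q₁ * (n₂ - q₂)) + q₁ * q₂ := by
    rintro _ ⟨M, hM, rfl⟩
    exact rank_le_of_mem_tensorSpace_compSpace (by omega) (by omega) (by omega) (by omega) hM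
  obtain ⟨M, hM, hrank⟩ := exists_mem_tensorSpace_compSpace_le_rank
    h₁.1.le h₁.2.le h₂.1.le h₂.2.le
  exact le_antisymm (csSup_le ⟨_, M, hM, rfl⟩ hle)
    (hrank.trans (le_csSup ⟨_, hle⟩ ⟨M, hM, rfl⟩))
end

section
/- Let p', q' be real numbers with p' > 0, q' > 0 and p'+q' < 1, and set α := log₂((1−q')/p') / ( log₂((1−q')/p') + log₂((1−p')/q') ). Then q' < α < 1 − p'. -/
open Matrix

/-- Gibbs' inequality for two Bernoulli distributions with parameters `q` and `1 - p`. -/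
lemma mul_log_div_lt_mul_log_div {p q : ℝ} (hp : 0 < p) (hq : 0 < q) (hpq : p + q < 1) :
    q * Real.log ((1 - p) / q) < (1 - q) * Real.log ((1 - q) / p) := by
  have hp1 : 0 < 1 - p := by linarith
  have hq1 : 0 < 1 - q := by linarith
  have h₁ : q * Real.log ((1 - p) / q) < 1 - p - q := by
    have h := Real.log_lt_sub_one_of_pos (div_pos hp1 hq)
      (by rw [Ne, div_eq_one_iff_eq hq.ne']; intro h; linarith)
    calc q * Real.log ((1 - p) / q) < q * ((1 - p) / q - 1) := mul_lt_mul_of_pos_left h hq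
      _ = 1 - p - q := by field_simp
  have h₂ : 1 - p - q < (1 - q) * Real.log ((1 - q) / p) := by
    have h := Real.log_lt_sub_one_of_pos (div_pos hp hq1)
      (by rw [Ne, div_eq_one_iff_eq hq1.ne']; intro h; linarith)
    rw [← inv_div, Real.log_inv]
    have h' : (1 - q) * Real.log (p / (1 - q)) < p - (1 - q) :=
      calc (1 - q) * Real.log (p / (1 - q)) < (1 - q) * (p / (1 - q) - 1) :=
            mul_lt_mul_of_pos_left h hq1
        _ = p - (1 - q) := by field_simp
    linarith
  exact h₁.trans h₂

theorem stmt17 (p' q' : ℝ) (hp : 0 < p') (hq : 0 < q') (hpq : p' + q' < 1) :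
    q' < Real.logb 2 ((1 - q') / p') /
          (Real.logb 2 ((1 - q') / p') + Real.logb 2 ((1 - p') / q')) ∧
    Real.logb 2 ((1 - q') / p') /
          (Real.logb 2 ((1 - q') / p') + Real.logb 2 ((1 - p') / q')) < 1 - p' := by
  have hA : 0 < Real.log ((1 - q') / p') :=
    Real.log_pos ((one_lt_div hp).2 (by linarith))
  have hB : 0 < Real.log ((1 - p') / q') :=
    Real.log_pos ((one_lt_div hq).2 (by linarith))
  have h₁ := mul_log_div_lt_mul_log_div hp hq hpq
  have h₂ := mul_log_div_lt_mul_log_div hq hp (by linarith)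
  have h2 : Real.log 2 ≠ 0 := (Real.log_pos one_lt_two).ne'
  rw [Real.logb, Real.logb, ← add_div, div_div_div_cancel_right₀ h2,
    lt_div_iff₀ (add_pos hA hB), div_lt_iff₀ (add_pos hA hB)]
  constructor <;> linarith
end
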